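/- Let A and B be finite sets, E ⊆ A × B a bipartite edge set, s : A → ℝ a score function, and set w a = −(s a). For a threshold h ∈ ℝ let E_h = {(a, b) ∈ E : s a > h}. Then for every threshold h ∈ ℝ and every optimal matching m of E there exists an optimal matching m_h of E_h with m_h ⊆ m. -/

import Mathlib

/-- A matching of a bipartite edge set `E ⊆ A × B`: a subset of `E` in which no two
distinct edges share a first coordinate and no two distinct edges share a second
coordinate. -/
def IsMatching {α β : Type*} (E m : Finset (α × β)) : Prop :=
  m ⊆ E ∧ (∀ e ∈ m, ∀ e' ∈ m, e.1 = e'.1 → e = e') ∧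
    (∀ e ∈ m, ∀ e' ∈ m, e.2 = e'.2 → e = e')

/-- The cost of a matching: the sum over its edges of the weight of the prediction
endpoint. -/
noncomputable def matchCost {α β : Type*} (w : α → ℝ) (m : Finset (α × β)) : ℝ :=
  ∑ e ∈ m, w e.1

/-- An optimal matching of `E` w.r.t. weights `w`: it has maximum cardinality among all
matchings of `E` and, among matchings of that maximum cardinality, minimum cost. -/
def IsOptimal {α β : Type*} (E : Finset (α × β)) (w : α → ℝ) (m : Finset (α × β)) : Prop :=
  IsMatching E m ∧ (∀ m', IsMatching E m' → m'.card ≤ m.card) ∧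
    (∀ m', IsMatching E m' → m'.card = m.card → matchCost w m ≤ matchCost w m')

/-- `I` is the set of first coordinates of some matching of `E`. -/
def IndSet {α β : Type*} [DecidableEq α] (E : Finset (α × β)) (I : Finset α) : Prop :=
  ∃ m, IsMatching E m ∧ m.image Prod.fst = I

lemma IsMatching.card_image {α β : Type*} [DecidableEq α] {E m : Finset (α × β)}
    (hm : IsMatching E m) : (m.image Prod.fst).card = m.card :=
  Finset.card_image_of_injOn fun e he e' he' h => hm.2.1 e he e' he' h

lemma IsMatching.card_image_snd {α β : Type*} [DecidableEq β] {E m : Finset (α × β)}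
    (hm : IsMatching E m) : (m.image Prod.snd).card = m.card :=
  Finset.card_image_of_injOn fun e he e' he' h => hm.2.2 e he e' he' h

lemma IsMatching.cost {α β : Type*} [DecidableEq α] {E m : Finset (α × β)} (w : α → ℝ)
    (hm : IsMatching E m) : matchCost w m = ∑ a ∈ m.image Prod.fst, w a := by
  rw [Finset.sum_image (fun e he e' he' h => hm.2.1 e he e' he' h)]
  rfl

lemma aug_aux {α β : Type*} [DecidableEq α] [DecidableEq β] (E M : Finset (α × β))
    (hM : IsMatching E M) (k : ℕ) : ∀ N, IsMatching E N → N.card < M.card →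
      (N \ M).card = k →
      ∃ a ∈ M.image Prod.fst, a ∉ N.image Prod.fst ∧ IndSet E (insert a (N.image Prod.fst)) := by
  induction k using Nat.strong_induction_on with
  | _ k ih =>
  intro N hN hlt hk
  obtain ⟨b, hbM, hbN⟩ : ∃ b ∈ M.image Prod.snd, b ∉ N.image Prod.snd := by
    by_contra! hc
    have := Finset.card_le_card (show M.image Prod.snd ⊆ N.image Prod.snd from hc)
    rw [hM.card_image_snd, hN.card_image_snd] at this
    omega
  obtain ⟨⟨a, b'⟩, habM, rfl⟩ := Finset.mem_image.1 hbM
  have hbN' : ∀ x, (x, b') ∉ N := fun x hx => hbN (Finset.mem_image.2 ⟨_, hx, rfl⟩)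
  obtain ⟨hN0, hN1, hN2⟩ := id hN
  obtain ⟨hM0, hM1, hM2⟩ := id hM
  by_cases ha : a ∈ N.image Prod.fst
  · obtain ⟨⟨a', c⟩, hacN, rfl⟩ := Finset.mem_image.1 ha
    simp only at habM ha hbM hbN
    have hne : c ≠ b' := by rintro rfl; exact hbN' _ hacN
    have hacM : (a', c) ∉ M := fun h => hne (by simpa using hM1 _ h _ habM rfl)
    have hN' : IsMatching E (insert (a', b') (N.erase (a', c))) := by
      refine ⟨?_, ?_, ?_⟩
      · intro e he
        simp only [Finset.mem_insert, Finset.mem_erase] at he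
        rcases he with rfl | he
        · exact hM0 habM
        · exact hN0 he.2
      · intro e he e' he' h
        simp only [Finset.mem_insert, Finset.mem_erase] at he he'
        rcases he with rfl | he <;> rcases he' with rfl | he'
        · rfl
        · exact absurd (hN1 _ he'.2 _ hacN h.symm) he'.1
        · exact absurd (hN1 _ he.2 _ hacN h) he.1
        · exact hN1 _ he.2 _ he'.2 h
      · intro e he e' he' h
        simp only [Finset.mem_insert, Finset.mem_erase] at he he'
        rcases he with rfl | he <;> rcases he' with rfl | he'
        · rfl
        · exact absurd (Finset.mem_image.2 ⟨_, he'.2, h.symm⟩) hbN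
        · exact absurd (Finset.mem_image.2 ⟨_, he.2, h⟩) hbN
        · exact hN2 _ he.2 _ he'.2 h
    have himg : (insert (a', b') (N.erase (a', c))).image Prod.fst = N.image Prod.fst := by
      conv_rhs => rw [← Finset.insert_erase hacN]
      simp [Finset.image_insert]
    have hcard : (insert (a', b') (N.erase (a', c))).card = N.card := by
      rw [← hN'.card_image, himg, hN.card_image]
    have hsub : insert (a', b') (N.erase (a', c)) \ M ⊂ N \ M := by
      rw [Finset.ssubset_iff_of_subset]
      · exact ⟨(a', c), by simp [hacN, hacM], by simp [hne]⟩
      · intro e he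
        simp only [Finset.mem_insert, Finset.mem_erase, Finset.mem_sdiff] at he ⊢
        rcases he with ⟨rfl | he, h2⟩
        · exact absurd habM h2
        · exact ⟨he.2, h2⟩
    have := ih _ (hk ▸ Finset.card_lt_card hsub) _ hN' (by omega) rfl
    rwa [himg] at this
  · refine ⟨a, Finset.mem_image.2 ⟨_, habM, rfl⟩, ha, insert (a, b') N, ⟨?_, ?_, ?_⟩, ?_⟩
    · exact Finset.insert_subset (hM0 habM) hN0
    · intro e he e' he' h
      simp only [Finset.mem_insert] at he he'
      rcases he with rfl | he <;> rcases he' with rfl | he'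
      · rfl
      · exact absurd (Finset.mem_image.2 ⟨_, he', h.symm⟩) ha
      · exact absurd (Finset.mem_image.2 ⟨_, he, h⟩) ha
      · exact hN1 _ he _ he' h
    · intro e he e' he' h
      simp only [Finset.mem_insert] at he he'
      rcases he with rfl | he <;> rcases he' with rfl | he'
      · rfl
      · exact absurd (Finset.mem_image.2 ⟨_, he', h.symm⟩) hbN
      · exact absurd (Finset.mem_image.2 ⟨_, he, h⟩) hbN
      · exact hN2 _ he _ he' h
    · simp [Finset.image_insert]

lemma IndSet.aug {α β : Type*} [DecidableEq α] [DecidableEq β] {E : Finset (α × β)}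
    {I J : Finset α} (hI : IndSet E I) (hJ : IndSet E J) (hlt : I.card < J.card) :
    ∃ a ∈ J, a ∉ I ∧ IndSet E (insert a I) := by
  obtain ⟨N, hN, rfl⟩ := hI
  obtain ⟨M, hM, rfl⟩ := hJ
  rw [hN.card_image, hM.card_image] at hlt
  exact aug_aux E M hM _ N hN hlt rfl

lemma IndSet.extend {α β : Type*} [DecidableEq α] [DecidableEq β] {E : Finset (α × β)}
    {J : Finset α} (hJ : IndSet E J) (k : ℕ) : ∀ I, IndSet E I → I.card + k = J.card →
    ∃ K, IndSet E K ∧ I ⊆ K ∧ K ⊆ I ∪ J ∧ K.card = J.card := by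
  induction k with
  | zero => intro I hI h; exact ⟨I, hI, subset_rfl, Finset.subset_union_left, h⟩
  | succ k ih =>
    intro I hI h
    obtain ⟨a, haJ, haI, hind⟩ := hI.aug hJ (by omega)
    obtain ⟨K, hK, h1, h2, h3⟩ := ih _ hind (by rw [Finset.card_insert_of_notMem haI]; omega)
    refine ⟨K, hK, (Finset.subset_insert _ _).trans h1, h2.trans ?_, h3⟩
    intro x hx
    simp only [Finset.mem_union, Finset.mem_insert] at hx ⊢
    rcases hx with (rfl | hx) | hx
    · exact Or.inr haJ
    · exact Or.inl hx
    · exact Or.inr hx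

/-- Threshold of a maximum weight basis. -/
lemma threshold_core {α β : Type*} [DecidableEq α] [DecidableEq β] {E : Finset (α × β)}
    (s w : α → ℝ) (hw : ∀ a, w a = -(s a)) (h : ℝ) (X : Finset α) (hX : IndSet E X)
    (hmax : ∀ I, IndSet E I → I.card ≤ X.card)
    (hmin : ∀ I, IndSet E I → I.card = X.card → ∑ a ∈ X, w a ≤ ∑ a ∈ I, w a)
    (hXh : IndSet E (X.filter fun a => s a > h)) :
    (∀ I, IndSet E I → (∀ a ∈ I, s a > h) → I.card ≤ (X.filter fun a => s a > h).card) := by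
  intro I hI hIh
  by_contra! hlt
  obtain ⟨a, haI, haX, hind⟩ := hXh.aug hI hlt
  have hsa := hIh a haI
  have haX' : a ∉ X := fun hx => haX (Finset.mem_filter.2 ⟨hx, hsa⟩)
  obtain ⟨k, hk⟩ := Nat.exists_eq_add_of_le (hmax _ hind)
  obtain ⟨K, hK, h1, h2, h3⟩ := hX.extend k _ hind hk.symm
  have haK : a ∈ K := h1 (Finset.mem_insert_self _ _)
  have hKsub : K.erase a ⊆ X := by
    intro x hx
    have hx' := h2 (Finset.mem_of_mem_erase hx)
    have := Finset.ne_of_mem_erase hx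
    simp only [Finset.mem_union, Finset.mem_insert, Finset.mem_filter] at hx'
    tauto
  have hc1 := Finset.card_erase_add_one haK
  have hc2 : (X \ K.erase a).card = 1 := by
    have := Finset.card_sdiff_add_card_eq_card hKsub
    omega
  obtain ⟨c, hc⟩ := Finset.card_eq_one.1 hc2
  have hcm : c ∈ X \ K.erase a := by rw [hc]; simp
  have hcX := (Finset.mem_sdiff.1 hcm).1
  have hcs : s c ≤ h := by
    by_contra! hcs
    refine (Finset.mem_sdiff.1 hcm).2 (Finset.mem_erase.2 ⟨?_, h1 ?_⟩)
    · rintro rfl; exact haX' hcX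
    · exact Finset.mem_insert_of_mem (Finset.mem_filter.2 ⟨hcX, hcs⟩)
  have e1 := Finset.sum_sdiff (f := w) hKsub
  have e2 := Finset.sum_erase_add K w haK
  have e3 := hmin K hK h3
  rw [hc, Finset.sum_singleton, hw] at e1
  rw [hw] at e2
  linarith

lemma threshold_cost {α β : Type*} [DecidableEq α] [DecidableEq β] {E : Finset (α × β)}
    (s w : α → ℝ) (h : ℝ) (X : Finset α) (hX : IndSet E X)
    (hmin : ∀ I, IndSet E I → I.card = X.card → ∑ a ∈ X, w a ≤ ∑ a ∈ I, w a)
    (hsub : ∀ K I, IndSet E K → I ⊆ K → IndSet E I)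
    (hcore : ∀ I, IndSet E I → (∀ a ∈ I, s a > h) →
      I.card ≤ (X.filter fun a => s a > h).card)
    (I : Finset α) (hI : IndSet E I) (hIh : ∀ a ∈ I, s a > h)
    (hcard : I.card = (X.filter fun a => s a > h).card) :
    ∑ a ∈ X.filter (fun a => s a > h), w a ≤ ∑ a ∈ I, w a := by
  have hle : I.card ≤ X.card := hcard ▸ Finset.card_filter_le _ _
  obtain ⟨k, hk⟩ := Nat.exists_eq_add_of_le hle
  obtain ⟨K, hK, h1, h2, h3⟩ := hX.extend k _ hI hk.symm
  have hKh : K.filter (fun a => s a > h) = I := by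
    symm
    apply Finset.eq_of_subset_of_card_le
    · intro x hx; exact Finset.mem_filter.2 ⟨h1 hx, hIh x hx⟩
    · rw [hcard]
      exact hcore _ (hsub _ _ hK (Finset.filter_subset _ _)) (fun a ha => (Finset.mem_filter.1 ha).2)
  have hKX : K.filter (fun a => ¬ s a > h) = X.filter (fun a => ¬ s a > h) := by
    apply Finset.eq_of_subset_of_card_le
    · intro x hx
      obtain ⟨hx1, hx2⟩ := Finset.mem_filter.1 hx
      refine Finset.mem_filter.2 ⟨?_, hx2⟩
      rcases Finset.mem_union.1 (h2 hx1) with hx3 | hx3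
      · exact absurd (hIh x hx3) hx2
      · exact hx3
    · have c1 := Finset.card_filter_add_card_filter_not (s := K) (fun a => s a > h)
      have c2 := Finset.card_filter_add_card_filter_not (s := X) (fun a => s a > h)
      rw [hKh] at c1
      omega
  have e1 := Finset.sum_filter_add_sum_filter_not K (fun a => s a > h) w
  have e2 := Finset.sum_filter_add_sum_filter_not X (fun a => s a > h) w
  rw [hKh, hKX] at e1
  have := hmin K hK h3
  linarith

lemma IsMatching.mono {α β : Type*} {E m n : Finset (α × β)} (hm : IsMatching E m)
    (h : n ⊆ m) : IsMatching E n :=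
  ⟨h.trans hm.1, fun e he e' he' => hm.2.1 e (h he) e' (h he'),
    fun e he e' he' => hm.2.2 e (h he) e' (h he')⟩

lemma IndSet.mono {α β : Type*} [DecidableEq α] {E : Finset (α × β)} (K I : Finset α)
    (hK : IndSet E K) (h : I ⊆ K) : IndSet E I := by
  obtain ⟨m, hm, rfl⟩ := hK
  refine ⟨m.filter fun e => e.1 ∈ I, hm.mono (Finset.filter_subset _ _), ?_⟩
  ext x
  simp only [Finset.mem_image, Finset.mem_filter]
  constructor
  · rintro ⟨e, he, rfl⟩; exact he.2
  · intro hx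
    obtain ⟨e, he, rfl⟩ := Finset.mem_image.1 (h hx)
    exact ⟨e, ⟨he, hx⟩, rfl⟩

/-- **Theorem 4.1.** With weights `w a = -(s a)` induced by scores `s` and thresholded
edge set `E_h = {(a, b) ∈ E : s a > h}`: for every threshold `h` and every optimal
matching `m` of `E` there exists an optimal matching `m_h` of `E_h` with `m_h ⊆ m`. -/
theorem exists_optimal_matching_subset_of_threshold {α β : Type*}
    [DecidableEq α] [DecidableEq β]
    (A : Finset α) (B : Finset β) (E : Finset (α × β)) (hE : E ⊆ A ×ˢ B)
    (s : α → ℝ) (w : α → ℝ) (hw : ∀ a, w a = -(s a)) :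
    ∀ (h : ℝ) (m : Finset (α × β)), IsOptimal E w m →
      ∃ m_h, IsOptimal (E.filter fun e => s e.1 > h) w m_h ∧ m_h ⊆ m := by
  intro h m hm
  obtain ⟨hm0, hmc, hmw⟩ := hm
  have hX : IndSet E (m.image Prod.fst) := ⟨m, hm0, rfl⟩
  have hmax : ∀ I, IndSet E I → I.card ≤ (m.image Prod.fst).card := by
    rintro _ ⟨n, hn, rfl⟩
    rw [hn.card_image, hm0.card_image]
    exact hmc n hn
  have hmin : ∀ I, IndSet E I → I.card = (m.image Prod.fst).card →
      ∑ a ∈ m.image Prod.fst, w a ≤ ∑ a ∈ I, w a := by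
    rintro _ ⟨n, hn, rfl⟩ hc
    rw [hn.card_image, hm0.card_image] at hc
    rw [← hn.cost, ← hm0.cost]
    exact hmw n hn hc
  have hcore := threshold_core s w hw h _ hX hmax hmin
    (IndSet.mono _ _ hX (Finset.filter_subset _ _))
  have hcost := threshold_cost s w h _ hX hmin IndSet.mono hcore
  have hmh : IsMatching E (m.filter fun e => s e.1 > h) := hm0.mono (Finset.filter_subset _ _)
  have himg : (m.filter fun e => s e.1 > h).image Prod.fst
      = (m.image Prod.fst).filter fun a => s a > h := by
    rw [Finset.filter_image]
  have key : ∀ n, IsMatching (E.filter fun e => s e.1 > h) n →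
      IsMatching E n ∧ ∀ a ∈ n.image Prod.fst, s a > h := by
    intro n hn
    refine ⟨⟨hn.1.trans (Finset.filter_subset _ _), hn.2⟩, ?_⟩
    intro a ha
    obtain ⟨e, he, rfl⟩ := Finset.mem_image.1 ha
    exact (Finset.mem_filter.1 (hn.1 he)).2
  refine ⟨m.filter fun e => s e.1 > h, ⟨⟨?_, hmh.2⟩, ?_, ?_⟩, Finset.filter_subset _ _⟩
  · exact Finset.filter_subset_filter _ hm0.1
  · intro n hn
    obtain ⟨hn1, hn2⟩ := key n hn
    rw [← hn1.card_image, ← hmh.card_image, himg]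
    exact hcore _ ⟨n, hn1, rfl⟩ hn2
  · intro n hn hc
    obtain ⟨hn1, hn2⟩ := key n hn
    rw [← hn1.card_image, ← hmh.card_image, himg] at hc
    rw [hn1.cost, hmh.cost, himg]
    exact hcost _ ⟨n, hn1, rfl⟩ hn2 hc
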